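/- (Triangle inequality) For compact metric measure spaces 𝕏 = (𝒳,d_𝒳,μ), 𝕐 = (𝒴,d_𝒴,ν) and ℤ = (𝒵,d_𝒵,κ), and any positive integer r and p,q ≥ 1, one has GW^{(r)}_{p,q}(𝕏,ℤ) ≤ GW^{(r)}_{p,q}(𝕏,𝕐) + GW^{(r)}_{p,q}(𝕐,ℤ). -/

import Mathlib

open MeasureTheory Metric Filter Set

namespace GWSOS

variable {X Y : Type*}

/-- The set of couplings of `μ` and `ν`. -/
def Couplings [MeasurableSpace X] [MeasurableSpace Y] (μ : Measure X) (ν : Measure Y) :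
    Set (Measure (X × Y)) :=
  {π | IsProbabilityMeasure π ∧ π.map Prod.fst = μ ∧ π.map Prod.snd = ν}

/-- The Gromov–Wasserstein value for cost `c`. -/
noncomputable def gwVal [MeasurableSpace X] [MeasurableSpace Y]
    (c : X × Y → X × Y → ℝ) (μ : Measure X) (ν : Measure Y) : ℝ :=
  ⨅ π : Couplings μ ν,
    ∫ z, c z.1 z.2 ∂((π : Measure (X × Y)).prod (π : Measure (X × Y)))

/-- (Sym): invariance under permutation of the `2r` coordinate pairs. -/
def SymCond [MeasurableSpace X] [MeasurableSpace Y] (r : ℕ)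
    (P : Measure (Fin (2 * r) → X × Y)) : Prop :=
  ∀ σ : Equiv.Perm (Fin (2 * r)), P.map (fun z => z ∘ σ) = P

/-- (Mar): marginal conditions. -/
def MarCond [MeasurableSpace X] [MeasurableSpace Y] (r : ℕ)
    (μ : Measure X) (ν : Measure Y) (P : Measure (Fin (2 * r) → X × Y)) : Prop :=
  ∀ i : Fin (2 * r),
    P.map (fun z => ((z i).1, fun j : {j : Fin (2 * r) // j ≠ i} => z j.1))
      = μ.prod (P.map (fun z (j : {j : Fin (2 * r) // j ≠ i}) => z j.1)) ∧
    P.map (fun z => ((z i).2, fun j : {j : Fin (2 * r) // j ≠ i} => z j.1))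
      = ν.prod (P.map (fun z (j : {j : Fin (2 * r) // j ≠ i}) => z j.1))

/-- (PSD+): the positive semidefiniteness condition. -/
def PSDCond [MeasurableSpace X] [MeasurableSpace Y] (r : ℕ)
    (P : Measure (Fin (2 * r) → X × Y)) : Prop :=
  ∀ (t : ℕ) (ht : t ≤ r) (f : (Fin t → X × Y) → ℝ) (g : (Fin (2 * r - 2 * t) → X × Y) → ℝ),
    Measurable f → (∃ M, ∀ w, |f w| ≤ M) →
    Measurable g → (∃ M, ∀ w, |g w| ≤ M) → (∀ w, 0 ≤ g w) →
    0 ≤ ∫ z, (f fun s => z ⟨s.1, by have := s.isLt; omega⟩)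
          * (f fun s => z ⟨t + s.1, by have := s.isLt; omega⟩)
          * (g fun s => z ⟨2 * t + s.1, by have := s.isLt; omega⟩) ∂P

/-- The feasible set `Π_r(μ,ν)` of the level-`r` relaxation. -/
def PiRSet [MeasurableSpace X] [MeasurableSpace Y] (r : ℕ)
    (μ : Measure X) (ν : Measure Y) : Set (Measure (Fin (2 * r) → X × Y)) :=
  {P | IsProbabilityMeasure P ∧ SymCond r P ∧ MarCond r μ ν P ∧ PSDCond r P}

/-- The level-`r` SOS value `gw^{(r)}(μ,ν)`. -/
noncomputable def gwRVal [MeasurableSpace X] [MeasurableSpace Y] (r : ℕ) (hr : 0 < r)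
    (c : X × Y → X × Y → ℝ) (μ : Measure X) (ν : Measure Y) : ℝ :=
  ⨅ P : PiRSet r μ ν,
    ∫ z, c (z ⟨0, by omega⟩) (z ⟨1, by omega⟩) ∂(P : Measure (Fin (2 * r) → X × Y))

/-- `c` is Lipschitz with constant `C` for the sum metric. -/
def LipCost [PseudoMetricSpace X] [PseudoMetricSpace Y] (C : ℝ)
    (c : X × Y → X × Y → ℝ) : Prop :=
  ∀ z₁ z₂ w₁ w₂ : X × Y,
    |c z₁ z₂ - c w₁ w₂|
      ≤ C * (dist z₁.1 w₁.1 + dist z₁.2 w₁.2 + dist z₂.1 w₂.1 + dist z₂.2 w₂.2)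

/-- The `L^{p,q}` distortion cost. -/
noncomputable def distCost [PseudoMetricSpace X] [PseudoMetricSpace Y] (p q : ℝ)
    (z w : X × Y) : ℝ :=
  |dist z.1 w.1 ^ q - dist z.2 w.2 ^ q| ^ p

end GWSOS

namespace GWSOS
open scoped NNReal ENNReal Topology

/-- A measure on `U × U × W` that is symmetric in the first two coordinates and whose integrals
against `φ(u) φ(u') γ(w)` with `γ ≥ 0` are nonnegative. -/
def IsPosSemidef {U W : Type*} [MeasurableSpace U] [MeasurableSpace W]
    (P : Measure (U × U × W)) : Prop :=
  P.map (fun z => (z.2.1, z.1, z.2.2)) = P ∧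
  ∀ (φ : U → ℝ) (γ : W → ℝ), Measurable φ → (∃ M, ∀ u, |φ u| ≤ M) →
    Measurable γ → (∃ M, ∀ w, |γ w| ≤ M) → (∀ w, 0 ≤ γ w) →
    0 ≤ ∫ z, φ z.1 * φ z.2.1 * γ z.2.2 ∂P

section PosSemidef

variable {U V W T : Type*} [MeasurableSpace U] [MeasurableSpace V] [MeasurableSpace W]
  [MeasurableSpace T]

lemma IsPosSemidef.map {I K : Type*} [MeasurableSpace I] [MeasurableSpace K]
    {P : Measure (U × U × W)} (hP : IsPosSemidef P) {α : U → I} {β : W → K}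
    (hα : Measurable α) (hβ : Measurable β) :
    IsPosSemidef (P.map (fun z => (α z.1, α z.2.1, β z.2.2))) := by
  refine ⟨?_, ?_⟩
  · rw [Measure.map_map (by fun_prop) (by fun_prop)]
    conv_rhs => rw [← hP.1, Measure.map_map (by fun_prop) (by fun_prop)]
    rfl
  · rintro φ γ hφ ⟨M, hM⟩ hγ ⟨N, hN⟩ hγ0
    rw [integral_map (by fun_prop) (by fun_prop)]
    exact hP.2 (φ ∘ α) (γ ∘ β) (by fun_prop) ⟨M, fun u => hM _⟩ (by fun_prop) ⟨N, fun w => hN _⟩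
      (fun w => hγ0 _)

lemma IsPosSemidef.posSemidef_matrix [Fintype U] [MeasurableSingletonClass U] [Fintype W]
    [MeasurableSingletonClass W] {P : Measure (U × U × W)} [IsFiniteMeasure P]
    (hP : IsPosSemidef P) (k : W) :
    (Matrix.of fun i j => P.real {(i, j, k)}).PosSemidef := by
  classical
  refine Matrix.PosSemidef.of_dotProduct_mulVec_nonneg ?_ fun x => ?_
  · ext i j
    simp only [Matrix.conjTranspose_apply, Matrix.of_apply, star_trivial]
    conv_lhs => rw [← hP.1]
    rw [measureReal_def, measureReal_def,
      Measure.map_apply (by fun_prop) (measurableSet_singleton _)]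
    congr 2
    ext ⟨a, b, c⟩
    simp only [mem_preimage, mem_singleton_iff, Prod.mk.injEq]
    tauto
  · have h := hP.2 x (fun w => if w = k then 1 else 0) (.of_discrete)
      ⟨∑ i, |x i|, fun u => Finset.single_le_sum (f := fun i => |x i|)
        (fun i _ => abs_nonneg _) (Finset.mem_univ u)⟩
      (.of_discrete) ⟨1, fun w => by split_ifs <;> simp⟩ (fun w => by split_ifs <;> simp)
    rw [integral_fintype .of_finite] at h
    refine h.trans_eq (Eq.symm ?_)
    simp only [dotProduct, Matrix.mulVec, Fintype.sum_prod_type, Finset.mul_sum]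
    refine Finset.sum_congr rfl fun i _ => Finset.sum_congr rfl fun j _ => ?_
    simp
    ring

/-- The product of two positive semidefinite measures on finite spaces is positive semidefinite. -/
lemma IsPosSemidef.integral_prod_nonneg_of_fintype
    [Fintype U] [MeasurableSingletonClass U] [Fintype V] [MeasurableSingletonClass V]
    [Fintype W] [MeasurableSingletonClass W] [Fintype T] [MeasurableSingletonClass T]
    {P : Measure (U × U × W)} {Q : Measure (V × V × T)} [IsFiniteMeasure P] [IsFiniteMeasure Q]
    (hP : IsPosSemidef P) (hQ : IsPosSemidef Q) (f : U × V → ℝ) (g : W × T → ℝ)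
    (hg : ∀ w, 0 ≤ g w) :
    0 ≤ ∫ z, f (z.1.1, z.2.1) * f (z.1.2.1, z.2.2.1) * g (z.1.2.2, z.2.2.2) ∂(P.prod Q) := by
  rw [integral_fintype .of_finite]
  have key : ∀ k l, 0 ≤ ∑ a : U × V, ∑ b : U × V,
      f a * (P.real {(a.1, b.1, k)} * Q.real {(a.2, b.2, l)}) * f b * g (k, l) := by
    intro k l
    have := (Matrix.posSemidef_iff_dotProduct_mulVec.1
      ((hP.posSemidef_matrix k).kronecker (hQ.posSemidef_matrix l))).2 f
    have := mul_nonneg this (hg (k, l))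
    refine this.trans_eq (Eq.symm ?_)
    simp only [dotProduct, Matrix.mulVec, Finset.mul_sum, Finset.sum_mul, Matrix.kroneckerMap_apply,
      Matrix.of_apply, star_trivial, Pi.star_apply]
    refine Finset.sum_congr rfl fun i _ => Finset.sum_congr rfl fun j _ => ?_
    ring
  have h := Finset.sum_nonneg fun (kl : W × T) (_ : kl ∈ Finset.univ) => key kl.1 kl.2
  refine h.trans_eq (Eq.symm ?_)
  have hreal : ∀ z : (U × U × W) × (V × V × T),
      (P.prod Q).real {z} = P.real {z.1} * Q.real {z.2} := by
    intro z
    rw [← measureReal_prod_prod, singleton_prod_singleton]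
  simp only [hreal, ← Finset.sum_product', Finset.univ_product_univ]
  refine Finset.sum_bij' (fun z _ => ((z.1.2.2, z.2.2.2), (z.1.1, z.2.1), (z.1.2.1, z.2.2.1)))
    (fun z _ => ((z.2.1.1, z.2.2.1, z.1.1), (z.2.1.2, z.2.2.2, z.1.2)))
    (by simp) (by simp) (by simp) (by simp) ?_
  intro z _
  simp only [smul_eq_mul]
  ring

end PosSemidef

lemma exists_continuous_seq_tendsto_ae {E : Type*} [MetricSpace E] [MeasurableSpace E]
    [BorelSpace E] (m : Measure E) [IsFiniteMeasure m] {f : E → ℝ} (hf : Measurable f) {a b : ℝ}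
    (hfab : ∀ x, f x ∈ Icc a b) :
    ∃ F : ℕ → E → ℝ, (∀ n, Continuous (F n)) ∧ (∀ n x, F n x ∈ Icc a b) ∧
      ∀ᵐ x ∂m, Tendsto (fun n => F n x) atTop (𝓝 (f x)) := by
  rcases isEmpty_or_nonempty E with hE | ⟨⟨x₀⟩⟩
  · exact ⟨fun _ => f, fun n => continuous_of_const fun x => hE.elim x, fun _ => hfab, by simp⟩
  have hab : a ≤ b := (hfab x₀).1.trans (hfab x₀).2
  have hmem : MemLp f 1 m := MemLp.of_bound hf.aestronglyMeasurable (max |a| |b|)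
    (ae_of_all _ fun x => abs_le_max_abs_abs (hfab x).1 (hfab x).2)
  choose G hG using fun n : ℕ => hmem.exists_boundedContinuous_eLpNorm_sub_le ENNReal.one_ne_top
    (ε := (n + 1 : ℝ≥0∞)⁻¹) (by simp [ENNReal.add_eq_top])
  have hlim : Tendsto (fun n => eLpNorm ((fun n => (G n : E → ℝ)) n - f) 1 m) atTop (𝓝 0) := by
    refine tendsto_of_tendsto_of_tendsto_of_le_of_le tendsto_const_nhds
      (h := fun n : ℕ => (n + 1 : ℝ≥0∞)⁻¹) ?_ (fun _ => zero_le) fun n => ?_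
    · simpa using (tendsto_add_atTop_iff_nat 1).2 ENNReal.tendsto_inv_nat_nhds_zero
    · rw [eLpNorm_sub_comm]
      exact (hG n).1
  obtain ⟨ns, -, hns⟩ := (tendstoInMeasure_of_tendsto_eLpNorm one_ne_zero
    (fun n => (G n).continuous.aestronglyMeasurable) hf.aestronglyMeasurable
    hlim).exists_seq_tendsto_ae
  refine ⟨fun n x => max a (min b (G (ns n) x)), fun n => by fun_prop,
    fun n x => ⟨le_max_left _ _, max_le hab (min_le_left _ _)⟩, ?_⟩
  filter_upwards [hns] with x hx
  have := (tendsto_const_nhds (x := a)).max ((tendsto_const_nhds (x := b)).min hx)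
  rwa [min_eq_right (hfab x).2, max_eq_right (hfab x).1] at this

section PosSemidefProd

variable {U V W T : Type*}
  [MetricSpace U] [SecondCountableTopology U] [MeasurableSpace U] [BorelSpace U]
  [MetricSpace V] [SecondCountableTopology V] [MeasurableSpace V] [BorelSpace V]
  [MetricSpace W] [SecondCountableTopology W] [MeasurableSpace W] [BorelSpace W]
  [MetricSpace T] [SecondCountableTopology T] [MeasurableSpace T] [BorelSpace T]
  {P : Measure (U × U × W)} {Q : Measure (V × V × T)}
  [IsProbabilityMeasure P] [IsProbabilityMeasure Q]

lemma IsPosSemidef.integral_prod_nonneg_of_simpleFunc (hP : IsPosSemidef P) (hQ : IsPosSemidef Q)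
    (a : SimpleFunc U U) (b : SimpleFunc V V) (c : SimpleFunc W W) (d : SimpleFunc T T)
    (f : U × V → ℝ) (g : W × T → ℝ) (hg : ∀ w, 0 ≤ g w) :
    0 ≤ ∫ z, f (a z.1.1, b z.2.1) * f (a z.1.2.1, b z.2.2.1) * g (c z.1.2.2, d z.2.2.2)
      ∂(P.prod Q) := by
  let α : U → a.range := fun u => ⟨a u, SimpleFunc.mem_range_self a u⟩
  let β : V → b.range := fun u => ⟨b u, SimpleFunc.mem_range_self b u⟩
  let γ : W → c.range := fun u => ⟨c u, SimpleFunc.mem_range_self c u⟩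
  let δ : T → d.range := fun u => ⟨d u, SimpleFunc.mem_range_self d u⟩
  have hα : Measurable α := a.measurable.subtype_mk
  have hβ : Measurable β := b.measurable.subtype_mk
  have hγ : Measurable γ := c.measurable.subtype_mk
  have hδ : Measurable δ := d.measurable.subtype_mk
  have h1 : Measurable fun z : U × U × W => (α z.1, α z.2.1, γ z.2.2) := by fun_prop
  have h2 : Measurable fun z : V × V × T => (β z.1, β z.2.1, δ z.2.2) := by fun_prop
  have := (hP.map hα hγ).integral_prod_nonneg_of_fintype (hQ.map hβ hδ)
    (fun z => f (z.1, z.2)) (fun z => g (z.1, z.2)) (fun z => hg _)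
  rw [Measure.map_prod_map _ _ h1 h2, integral_map (by fun_prop) (by fun_prop)] at this
  exact this

lemma abs_mul_mul_le {x y z M N : ℝ} (hx : |x| ≤ M) (hy : |y| ≤ M) (hz : |z| ≤ N) :
    ‖x * y * z‖ ≤ M * M * N := by
  have hM := (abs_nonneg x).trans hx
  rw [norm_mul, norm_mul, Real.norm_eq_abs, Real.norm_eq_abs, Real.norm_eq_abs]
  gcongr

lemma IsPosSemidef.integral_prod_nonneg_of_continuous (hP : IsPosSemidef P) (hQ : IsPosSemidef Q)
    (f : U × V → ℝ) (g : W × T → ℝ) (hf : Continuous f) {M N : ℝ} (hfM : ∀ w, |f w| ≤ M)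
    (hgc : Continuous g) (hgN : ∀ w, |g w| ≤ N) (hg : ∀ w, 0 ≤ g w) :
    0 ≤ ∫ z, f (z.1.1, z.2.1) * f (z.1.2.1, z.2.2.1) * g (z.1.2.2, z.2.2.2) ∂(P.prod Q) := by
  obtain ⟨⟨u₀, -, w₀⟩⟩ := P.nonempty_of_neZero
  obtain ⟨⟨v₀, -, t₀⟩⟩ := Q.nonempty_of_neZero
  have : Nonempty U := ⟨u₀⟩
  have : Nonempty V := ⟨v₀⟩
  have : Nonempty W := ⟨w₀⟩
  have : Nonempty T := ⟨t₀⟩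
  let a := SimpleFunc.nearestPt (TopologicalSpace.denseSeq U)
  let b := SimpleFunc.nearestPt (TopologicalSpace.denseSeq V)
  let c := SimpleFunc.nearestPt (TopologicalSpace.denseSeq W)
  let d := SimpleFunc.nearestPt (TopologicalSpace.denseSeq T)
  have ha : ∀ u, Tendsto (fun n => a n u) atTop (𝓝 u) := fun u =>
    SimpleFunc.tendsto_nearestPt (TopologicalSpace.denseRange_denseSeq U u)
  have hb : ∀ u, Tendsto (fun n => b n u) atTop (𝓝 u) := fun u =>
    SimpleFunc.tendsto_nearestPt (TopologicalSpace.denseRange_denseSeq V u)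
  have hc : ∀ u, Tendsto (fun n => c n u) atTop (𝓝 u) := fun u =>
    SimpleFunc.tendsto_nearestPt (TopologicalSpace.denseRange_denseSeq W u)
  have hd : ∀ u, Tendsto (fun n => d n u) atTop (𝓝 u) := fun u =>
    SimpleFunc.tendsto_nearestPt (TopologicalSpace.denseRange_denseSeq T u)
  refine ge_of_tendsto' (tendsto_integral_of_dominated_convergence
    (F := fun n z => f (a n z.1.1, b n z.2.1) * f (a n z.1.2.1, b n z.2.2.1)
      * g (c n z.1.2.2, d n z.2.2.2)) (fun _ => M * M * N) (fun n => ?_) (by fun_prop)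
    (fun n => ae_of_all _ fun z => abs_mul_mul_le (hfM _) (hfM _) (hgN _))
    (ae_of_all _ fun z => ?_))
    fun n => hP.integral_prod_nonneg_of_simpleFunc hQ (a n) (b n) (c n) (d n) f g hg
  · have := hf.measurable
    have := hgc.measurable
    have := (a n).measurable
    have := (b n).measurable
    have := (c n).measurable
    have := (d n).measurable
    exact Measurable.aestronglyMeasurable (by fun_prop)
  · exact ((hf.tendsto _).comp ((ha _).prodMk_nhds (hb _))).mul
      ((hf.tendsto _).comp ((ha _).prodMk_nhds (hb _))) |>.mul
      ((hgc.tendsto _).comp ((hc _).prodMk_nhds (hd _)))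

/-- The product of two positive semidefinite measures is positive semidefinite. -/
lemma IsPosSemidef.integral_prod_nonneg (hP : IsPosSemidef P) (hQ : IsPosSemidef Q)
    (f : U × V → ℝ) (g : W × T → ℝ) (hf : Measurable f) {M N : ℝ} (hfM : ∀ w, |f w| ≤ M)
    (hgm : Measurable g) (hgN : ∀ w, |g w| ≤ N) (hg : ∀ w, 0 ≤ g w) :
    0 ≤ ∫ z, f (z.1.1, z.2.1) * f (z.1.2.1, z.2.2.1) * g (z.1.2.2, z.2.2.2) ∂(P.prod Q) := by
  let e₁ : (U × U × W) × (V × V × T) → U × V := fun z => (z.1.1, z.2.1)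
  let e₂ : (U × U × W) × (V × V × T) → U × V := fun z => (z.1.2.1, z.2.2.1)
  let e₃ : (U × U × W) × (V × V × T) → W × T := fun z => (z.1.2.2, z.2.2.2)
  have he₁ : Measurable e₁ := by fun_prop
  have he₂ : Measurable e₂ := by fun_prop
  have he₃ : Measurable e₃ := by fun_prop
  obtain ⟨F, hFc, hFM, hF⟩ := exists_continuous_seq_tendsto_ae
    ((P.prod Q).map e₁ + (P.prod Q).map e₂) hf (fun x => abs_le.1 (hfM x))
  obtain ⟨G, hGc, hGN, hG⟩ := exists_continuous_seq_tendsto_ae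
    ((P.prod Q).map e₃) hgm (fun x => ⟨hg x, (abs_le.1 (hgN x)).2⟩)
  rw [ae_add_measure_iff] at hF
  have hGN' : ∀ n x, |G n x| ≤ N := fun n x => by
    rw [abs_of_nonneg (hGN n x).1]
    exact (hGN n x).2
  refine ge_of_tendsto' (tendsto_integral_of_dominated_convergence
    (F := fun n z => F n (e₁ z) * F n (e₂ z) * G n (e₃ z)) (fun _ => M * M * N) (fun n => ?_)
    (by fun_prop)
    (fun n => ae_of_all _ fun z => abs_mul_mul_le (abs_le.2 (hFM n _)) (abs_le.2 (hFM n _))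
      (hGN' n _)) ?_)
    fun n => hP.integral_prod_nonneg_of_continuous hQ (F n) (G n) (hFc n)
      (fun x => abs_le.2 (hFM n x)) (hGc n) (hGN' n) (fun x => (hGN n x).1)
  · have := (hFc n).measurable
    have := (hGc n).measurable
    exact Measurable.aestronglyMeasurable (by fun_prop)
  · filter_upwards [ae_of_ae_map he₁.aemeasurable hF.1, ae_of_ae_map he₂.aemeasurable hF.2,
      ae_of_ae_map he₃.aemeasurable hG] with z h₁ h₂ h₃
    exact (h₁.mul h₂).mul h₃

end PosSemidefProd

section Weight

variable {Y I : Type*} [MeasurableSpace Y]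

open scoped Classical in
/-- The weight that couples points of `Y` lying in the same cell of the partition given by `c`,
normalised so that it integrates to one against `ν`. -/
noncomputable def cellWeight (ν : Measure Y) (c : Y → I) (y y' : Y) : ℝ≥0 :=
  if c y = c y' then (ν (c ⁻¹' {c y})).toNNReal⁻¹ else 0

lemma cellWeight_comm (ν : Measure Y) (c : Y → I) (y y' : Y) :
    cellWeight ν c y y' = cellWeight ν c y' y := by
  unfold cellWeight
  by_cases h : c y = c y'
  · simp [h]
  · simp [h, Ne.symm h]

lemma eq_of_cellWeight_ne_zero {ν : Measure Y} {c : Y → I} {y y' : Y}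
    (h : cellWeight ν c y y' ≠ 0) : c y = c y' := by
  by_contra hc
  exact h (by simp [cellWeight, hc])

lemma exists_cellWeight_le [Finite I] (ν : Measure Y) (c : Y → I) :
    ∃ C, ∀ y y', cellWeight ν c y y' ≤ C := by
  obtain ⟨C, hC⟩ := (Set.finite_range fun i : I => (ν (c ⁻¹' {i})).toNNReal⁻¹).bddAbove
  refine ⟨C, fun y y' => ?_⟩
  unfold cellWeight
  split_ifs
  · exact hC ⟨_, rfl⟩
  · exact zero_le

variable [MeasurableSpace I] [Finite I] [MeasurableSingletonClass I]

lemma measurable_cellWeight (ν : Measure Y) {c : Y → I} (hc : Measurable c) :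
    Measurable (fun z : Y × Y => cellWeight ν c z.1 z.2) := by
  classical
  have h : Measurable fun z : I × I => if z.1 = z.2 then (ν (c ⁻¹' {z.1})).toNNReal⁻¹ else 0 :=
    .of_discrete
  have := h.comp (f := fun z : Y × Y => (c z.1, c z.2)) (by fun_prop)
  convert this using 2 with z
  simp only [cellWeight, Function.comp]

lemma lintegral_cellWeight (ν : Measure Y) [IsFiniteMeasure ν] {c : Y → I} (hc : Measurable c) :
    ∀ᵐ y ∂ν, ∫⁻ y', cellWeight ν c y y' ∂ν = 1 := by
  have : ∀ᵐ y ∂ν, ∀ i : I, ν (c ⁻¹' {i}) = 0 → c y ≠ i := by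
    rw [ae_all_iff]
    intro i
    by_cases hi : ν (c ⁻¹' {i}) = 0
    · rw [ae_iff]
      simp only [hi, forall_const, ne_eq, not_not]
      exact hi
    · simp [hi]
  filter_upwards [this] with y hy
  have hne : ν (c ⁻¹' {c y}) ≠ 0 := fun h => hy _ h rfl
  have hfun : (fun y' => (cellWeight ν c y y' : ℝ≥0∞))
      = (c ⁻¹' {c y}).indicator fun _ => (ν (c ⁻¹' {c y}))⁻¹ := by
    ext y'
    by_cases h : c y = c y'
    · rw [indicator_of_mem (by simp [h])]
      simp only [cellWeight, h, if_true]
      rw [h] at hne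
      rw [ENNReal.coe_inv (by simp [ENNReal.toNNReal_eq_zero_iff, hne]),
        ENNReal.coe_toNNReal (measure_ne_top _ _)]
    · rw [indicator_of_notMem (by simpa using Ne.symm h)]
      simp [cellWeight, h]
  rw [hfun, lintegral_indicator (hc (measurableSet_singleton _)), setLIntegral_const,
    ENNReal.inv_mul_cancel hne (measure_ne_top _ _)]

end Weight

/-- A weight of conditional mean one against an independent variable can be integrated out. -/
lemma lintegral_weight_mul {Ω₁ Ω₂ Y V : Type*} [MeasurableSpace Ω₁] [MeasurableSpace Ω₂]
    [MeasurableSpace Y] [MeasurableSpace V] {P : Measure Ω₁} {Q : Measure Ω₂} {ν : Measure Y}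
    [IsProbabilityMeasure Q] {Y₁ : Ω₁ → Y} {Y₂ : Ω₂ → Y} {V₂ : Ω₂ → V} (hY₁ : Measurable Y₁)
    (hY₂ : Measurable Y₂) (hV₂ : Measurable V₂) (h₁ : P.map Y₁ = ν)
    (h₂ : Q.map (fun ω => (Y₂ ω, V₂ ω)) = ν.prod (Q.map V₂)) {w : Y → Y → ℝ≥0}
    (hw : Measurable fun z : Y × Y => w z.1 z.2) (hw1 : ∀ᵐ y ∂ν, ∫⁻ y', w y y' ∂ν = 1)
    {ψ : Ω₁ → V → ℝ≥0∞} (hψ : Measurable fun z : Ω₁ × V => ψ z.1 z.2) :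
    ∫⁻ a, ∫⁻ b, w (Y₁ a) (Y₂ b) * ψ a (V₂ b) ∂Q ∂P = ∫⁻ a, ∫⁻ b, ψ a (V₂ b) ∂Q ∂P := by
  have : IsProbabilityMeasure (Q.map V₂) := Measure.isProbabilityMeasure_map hV₂.aemeasurable
  rw [← h₁] at hw1
  refine lintegral_congr_ae ?_
  filter_upwards [ae_of_ae_map hY₁.aemeasurable hw1] with a ha
  rw [h₁] at ha
  have hwa : Measurable fun y => w (Y₁ a) y := hw.comp (measurable_const.prodMk measurable_id)
  have hψa : Measurable fun v => ψ a v := hψ.comp (measurable_const.prodMk measurable_id)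
  have e : ∫⁻ b, w (Y₁ a) (Y₂ b) * ψ a (V₂ b) ∂Q
      = ∫⁻ z, w (Y₁ a) z.1 * ψ a z.2 ∂(Q.map (fun ω => (Y₂ ω, V₂ ω))) := by
    rw [lintegral_map (by fun_prop) (by fun_prop)]
  rw [e, h₂, lintegral_prod_mul (f := fun y => (w (Y₁ a) y : ℝ≥0∞)) (by fun_prop) (by fun_prop),
    ha, one_mul, lintegral_map hψa hV₂]

section DropAt

variable {ι A X : Type*} [MeasurableSpace A] [MeasurableSpace X]

/-- The tuple with the `i`-th entry removed. -/
def dropAt (i : ι) (a : ι → A) : {j // j ≠ i} → A := fun j => a j.1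

lemma measurable_dropAt (i : ι) : Measurable (dropAt i : (ι → A) → _) := by
  unfold dropAt
  fun_prop

lemma map_eq_of_map_prod {μ : Measure X} {x : A → X} (hx : Measurable x)
    {P : Measure (ι → A)} [IsProbabilityMeasure P] {i : ι}
    (h : P.map (fun a => (x (a i), dropAt i a)) = μ.prod (P.map (dropAt i))) :
    P.map (fun a => x (a i)) = μ := by
  have hd := measurable_dropAt (A := A) i
  have : IsProbabilityMeasure (P.map (dropAt i)) :=
    Measure.isProbabilityMeasure_map hd.aemeasurable
  have := congrArg (Measure.map Prod.fst) h
  rwa [Measure.map_map (by fun_prop) (by fun_prop), Measure.map_fst_prod, measure_univ,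
    one_smul] at this

end DropAt

section Glue

variable {ι A B Y X : Type*} [Fintype ι] [MeasurableSpace A] [MeasurableSpace B]
  [MeasurableSpace Y] [MeasurableSpace X]

/-- The gluing of `P` and `Q` along the weight `w` between the `Y`-components. -/
noncomputable def glue (P : Measure (ι → A)) (Q : Measure (ι → B)) (w : Y → Y → ℝ≥0)
    (yA : A → Y) (yB : B → Y) : Measure ((ι → A) × (ι → B)) :=
  (P.prod Q).withDensity fun ω => ((∏ i, w (yA (ω.1 i)) (yB (ω.2 i)) : ℝ≥0) : ℝ≥0∞)

variable {P : Measure (ι → A)} {Q : Measure (ι → B)} {w : Y → Y → ℝ≥0} {yA : A → Y} {yB : B → Y}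
  {ν : Measure Y}

lemma measurable_weight (hw : Measurable fun z : Y × Y => w z.1 z.2) (hyA : Measurable yA)
    (hyB : Measurable yB) : Measurable fun z : A × B => w (yA z.1) (yB z.2) :=
  hw.comp (f := fun z : A × B => (yA z.1, yB z.2)) (by fun_prop)

lemma measurable_prod_weight {κ : Type*} [Fintype κ] (hw : Measurable fun z : Y × Y => w z.1 z.2)
    (hyA : Measurable yA) (hyB : Measurable yB) :
    Measurable fun ω : (κ → A) × (κ → B) => ∏ i, w (yA (ω.1 i)) (yB (ω.2 i)) :=
  Finset.measurable_prod _ fun i _ => (measurable_weight hw hyA hyB).comp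
    (f := fun ω : (κ → A) × (κ → B) => (ω.1 i, ω.2 i)) (by fun_prop)

lemma lintegral_glue [SFinite Q] (hw : Measurable fun z : Y × Y => w z.1 z.2) (hyA : Measurable yA)
    (hyB : Measurable yB) {F : (ι → A) × (ι → B) → ℝ≥0∞} (hF : Measurable F) :
    ∫⁻ ω, F ω ∂(glue P Q w yA yB)
      = ∫⁻ a, ∫⁻ b, (∏ i, w (yA (a i)) (yB (b i)) : ℝ≥0) * F (a, b) ∂Q ∂P := by
  have := measurable_prod_weight (κ := ι) hw hyA hyB
  rw [glue, lintegral_withDensity_eq_lintegral_mul _ (by fun_prop) hF,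
    lintegral_prod _ (by fun_prop)]
  rfl

lemma glue_map_swap [SFinite P] [SFinite Q]
    (hw : Measurable fun z : Y × Y => w z.1 z.2) (hyA : Measurable yA) (hyB : Measurable yB)
    (hsymm : ∀ y y', w y y' = w y' y) :
    (glue P Q w yA yB).map Prod.swap = glue Q P w yB yA := by
  refine Measure.ext_of_lintegral _ fun F hF => ?_
  have := measurable_prod_weight (κ := ι) hw hyA hyB
  rw [lintegral_map hF measurable_swap, lintegral_glue hw hyA hyB (by fun_prop),
    lintegral_glue hw hyB hyA hF, lintegral_lintegral_swap]
  · simp_rw [hsymm (yA _), Prod.swap_prod_mk]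
  · exact Measurable.aemeasurable (by unfold Function.uncurry; fun_prop)

lemma glue_map_fst [IsProbabilityMeasure Q]
    (hw : Measurable fun z : Y × Y => w z.1 z.2) (hyA : Measurable yA) (hyB : Measurable yB)
    (hw1 : ∀ᵐ y ∂ν, ∫⁻ y', w y y' ∂ν = 1)
    (hP : ∀ i, P.map (fun a => yA (a i)) = ν)
    (hQ : ∀ i, Q.map (fun b => (yB (b i), dropAt i b)) = ν.prod (Q.map (dropAt i))) :
    (glue P Q w yA yB).map Prod.fst = P := by
  classical
  refine Measure.ext_of_lintegral _ fun F hF => ?_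
  rw [lintegral_map hF measurable_fst, lintegral_glue hw hyA hyB (by fun_prop)]
  have key : ∀ S : Finset ι,
      ∫⁻ a, ∫⁻ b, (∏ i ∈ S, w (yA (a i)) (yB (b i)) : ℝ≥0) * F a ∂Q ∂P = ∫⁻ a, F a ∂P := by
    intro S
    induction S using Finset.induction_on with
    | empty => simp
    | insert i S hi ih =>
      have hne : ∀ j ∈ S, j ≠ i := fun j hj h => hi (h ▸ hj)
      have hψ : Measurable fun z : (ι → A) × ({j // j ≠ i} → B) =>
          ((∏ j ∈ S.attach, w (yA (z.1 j)) (yB (z.2 ⟨j, hne j j.2⟩)) : ℝ≥0) : ℝ≥0∞) * F z.1 := by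
        refine Measurable.mul (Measurable.coe_nnreal_ennreal ?_) (by fun_prop)
        exact Finset.measurable_prod _ fun j _ => (measurable_weight hw hyA hyB).comp
          (f := fun z : (ι → A) × ({j // j ≠ i} → B) => (z.1 j, z.2 ⟨j, hne j j.2⟩)) (by fun_prop)
      have h := lintegral_weight_mul (P := P) (Q := Q) (Y₁ := fun a => yA (a i))
        (Y₂ := fun b => yB (b i)) (V₂ := dropAt i) (by fun_prop) (by fun_prop)
        (measurable_dropAt i) (hP i) (hQ i) hw hw1 (ψ := fun a v =>
          ((∏ j ∈ S.attach, w (yA (a j)) (yB (v ⟨j, hne j j.2⟩)) : ℝ≥0) : ℝ≥0∞) * F a) hψ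
      have hatt : ∀ (a : ι → A) (b : ι → B),
          ∏ j ∈ S.attach, w (yA (a j)) (yB (dropAt i b ⟨j, hne j j.2⟩))
          = ∏ j ∈ S, w (yA (a j)) (yB (b j)) := fun a b =>
        Finset.prod_attach S fun j => w (yA (a j)) (yB (b j))
      simp only [hatt] at h
      rw [ih] at h
      simpa only [Finset.prod_insert hi, ENNReal.coe_mul, mul_assoc] using h
  exact key Finset.univ

lemma glue_map_fst_dropAt [IsProbabilityMeasure P] [IsProbabilityMeasure Q]
    {μ : Measure X} [IsProbabilityMeasure μ] {xA : A → X}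
    (hw : Measurable fun z : Y × Y => w z.1 z.2) (hyA : Measurable yA)
    (hyB : Measurable yB) (hxA : Measurable xA) (hw1 : ∀ᵐ y ∂ν, ∫⁻ y', w y y' ∂ν = 1) (i : ι)
    [IsFiniteMeasure (glue P Q w yA yB)]
    (hP : P.map (fun a => yA (a i)) = ν)
    (hPx : P.map (fun a => (xA (a i), dropAt i a)) = μ.prod (P.map (dropAt i)))
    (hQ : Q.map (fun b => (yB (b i), dropAt i b)) = ν.prod (Q.map (dropAt i))) :
    (glue P Q w yA yB).map (fun ω => (xA (ω.1 i), dropAt i ω.1, dropAt i ω.2))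
      = μ.prod ((glue P Q w yA yB).map (fun ω => (dropAt i ω.1, dropAt i ω.2))) := by
  classical
  have hdA := measurable_dropAt (A := A) i
  have hdB := measurable_dropAt (A := B) i
  have : IsProbabilityMeasure (P.map (dropAt i)) :=
    Measure.isProbabilityMeasure_map hdA.aemeasurable
  have hprod := measurable_prod_weight (κ := {j // j ≠ i}) hw hyA hyB
  have split : ∀ {φ : X → ℝ≥0∞} {F : ({j // j ≠ i} → A) × ({j // j ≠ i} → B) → ℝ≥0∞},
      Measurable φ → Measurable F →
      ∫⁻ ω, φ (xA (ω.1 i)) * F (dropAt i ω.1, dropAt i ω.2) ∂(glue P Q w yA yB)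
      = (∫⁻ x, φ x ∂μ) * ∫⁻ b, ∫⁻ u, (∏ j, w (yA (u j)) (yB (dropAt i b j)) : ℝ≥0)
          * F (u, dropAt i b) ∂(P.map (dropAt i)) ∂Q := by
    intro φ F hφ hF
    let ψ : (ι → A) → ({j // j ≠ i} → B) → ℝ≥0∞ := fun a v => φ (xA (a i)) *
      ((∏ j, w (yA (dropAt i a j)) (yB (v j)) : ℝ≥0) * F (dropAt i a, v))
    have hψ : Measurable fun z : (ι → A) × ({j // j ≠ i} → B) => ψ z.1 z.2 := by
      have := hprod.comp (f := fun z : (ι → A) × ({j // j ≠ i} → B) => (dropAt i z.1, z.2))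
        (by fun_prop)
      simp only [Function.comp_def] at this
      fun_prop
    have h := lintegral_weight_mul (P := P) (Q := Q) (Y₁ := fun a => yA (a i))
        (Y₂ := fun b => yB (b i)) (V₂ := dropAt i) (by fun_prop) (by fun_prop)
        hdB hP hQ hw hw1 (ψ := ψ) hψ
    rw [lintegral_glue hw hyA hyB (by fun_prop)]
    have e : ∀ a b, ((∏ j, w (yA (a j)) (yB (b j)) : ℝ≥0) : ℝ≥0∞)
          * (φ (xA (a i)) * F (dropAt i a, dropAt i b))
        = w (yA (a i)) (yB (b i)) * ψ a (dropAt i b) := by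
      intro a b
      rw [Fintype.prod_eq_mul_prod_subtype_ne _ i, ENNReal.coe_mul]
      simp only [ψ, dropAt]
      ring
    simp only [e]
    rw [h, lintegral_lintegral_swap (f := fun a b => ψ a (dropAt i b))
      (hψ.comp (f := fun z : (ι → A) × (ι → B) => (z.1, dropAt i z.2)) (by fun_prop)).aemeasurable,
      ← lintegral_const_mul]
    · refine lintegral_congr fun b => ?_
      have hb : Measurable fun u : {j // j ≠ i} → A =>
          ((∏ j, w (yA (u j)) (yB (dropAt i b j)) : ℝ≥0) : ℝ≥0∞) :=
        (hprod.comp (f := fun u => (u, dropAt i b)) (by fun_prop)).coe_nnreal_ennreal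
      have e2 : ∫⁻ a, ψ a (dropAt i b) ∂P = ∫⁻ z, φ z.1 *
          ((∏ j, w (yA (z.2 j)) (yB (dropAt i b j)) : ℝ≥0) * F (z.2, dropAt i b))
          ∂(P.map (fun a => (xA (a i), dropAt i a))) := by
        rw [lintegral_map (by fun_prop) (by fun_prop)]
      rw [e2, hPx, lintegral_prod_mul (g := fun u =>
        ((∏ j, w (yA (u j)) (yB (dropAt i b j)) : ℝ≥0) : ℝ≥0∞) * F (u, dropAt i b))
        (by fun_prop) (by fun_prop)]
    · refine Measurable.lintegral_prod_right (f := fun (b : ι → B) (u : {j // j ≠ i} → A) =>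
        ((∏ j, w (yA (u j)) (yB (dropAt i b j)) : ℝ≥0) : ℝ≥0∞) * F (u, dropAt i b)) ?_
      have := hprod.comp (f := fun z : (ι → B) × ({j // j ≠ i} → A) => (z.2, dropAt i z.1))
        (by fun_prop)
      simp only [Function.comp_def] at this
      unfold Function.uncurry
      fun_prop
  symm
  refine Measure.prod_eq fun s t hs ht => ?_
  have h1 := split (φ := s.indicator 1) (F := t.indicator 1) (measurable_one.indicator hs)
    (measurable_one.indicator ht)
  have h2 := split (φ := 1) (F := t.indicator 1) measurable_one
    (measurable_one.indicator ht)
  simp only [Pi.one_apply, one_mul, lintegral_const, measure_univ, mul_one] at h2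
  rw [← h2, lintegral_indicator_one hs] at h1
  rw [← lintegral_indicator_one (hs.prod ht), ← lintegral_indicator_one (μ := Measure.map _ _) ht,
    lintegral_map (measurable_one.indicator (hs.prod ht)) (by fun_prop),
    lintegral_map (measurable_one.indicator ht) (by fun_prop), ← h1]
  refine lintegral_congr fun ω => ?_
  by_cases h : xA (ω.1 i) ∈ s <;> by_cases h' : (dropAt i ω.1, dropAt i ω.2) ∈ t <;>
    simp [h, h']

lemma ae_glue_weight_ne_zero (hw : Measurable fun z : Y × Y => w z.1 z.2) (hyA : Measurable yA)
    (hyB : Measurable yB) :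
    ∀ᵐ ω ∂(glue P Q w yA yB), ∀ i, w (yA (ω.1 i)) (yB (ω.2 i)) ≠ 0 := by
  rw [glue, ae_withDensity_iff (measurable_prod_weight hw hyA hyB).coe_nnreal_ennreal]
  refine ae_of_all _ fun ω h i h0 => h ?_
  rw [Finset.prod_eq_zero (Finset.mem_univ i) h0, ENNReal.coe_zero]

lemma glue_map_comp_perm [SFinite P] [SFinite Q]
    (hw : Measurable fun z : Y × Y => w z.1 z.2) (hyA : Measurable yA) (hyB : Measurable yB)
    (σ : Equiv.Perm ι) (hP : P.map (fun a => a ∘ σ) = P)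
    (hQ : Q.map (fun b => b ∘ σ) = Q) :
    (glue P Q w yA yB).map (fun ω => (ω.1 ∘ σ, ω.2 ∘ σ)) = glue P Q w yA yB := by
  have hσA : Measurable fun a : ι → A => a ∘ σ := by unfold Function.comp; fun_prop
  have hσB : Measurable fun a : ι → B => a ∘ σ := by unfold Function.comp; fun_prop
  have hm : Measurable fun ω : (ι → A) × (ι → B) => (ω.1 ∘ σ, ω.2 ∘ σ) := by fun_prop
  have hprod := measurable_prod_weight (κ := ι) hw hyA hyB
  refine Measure.ext_of_lintegral _ fun F hF => ?_
  rw [lintegral_map hF hm, glue,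
    lintegral_withDensity_eq_lintegral_mul _ (by fun_prop) (by fun_prop),
    lintegral_withDensity_eq_lintegral_mul _ (by fun_prop) hF]
  conv_rhs => rw [← hP, ← hQ, Measure.map_prod_map _ _ hσA hσB,
    lintegral_map (by fun_prop) (by fun_prop)]
  refine lintegral_congr fun ω => ?_
  simp only [Pi.mul_apply, Prod.map, Function.comp]
  congr 2
  exact (Equiv.prod_comp σ fun i => w (yA (ω.1 i)) (yB (ω.2 i))).symm

end Glue

section Split

variable {S : Type*} {r t : ℕ}

/-- The blocks of lengths `t`, `t` and `2 * r - 2 * t` of a `2 * r`-tuple. -/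
def splitTuple (ht : t ≤ r) (z : Fin (2 * r) → S) :
    (Fin t → S) × (Fin t → S) × (Fin (2 * r - 2 * t) → S) :=
  (fun s => z ⟨s.1, by have := s.isLt; omega⟩, fun s => z ⟨t + s.1, by have := s.isLt; omega⟩,
    fun s => z ⟨2 * t + s.1, by have := s.isLt; omega⟩)

lemma measurable_splitTuple [MeasurableSpace S] (ht : t ≤ r) :
    Measurable (splitTuple ht : (Fin (2 * r) → S) → _) := by
  unfold splitTuple
  fun_prop

lemma prod_split {M : Type*} [CommMonoid M] (ht : t ≤ r) (F : Fin (2 * r) → M) :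
    ∏ i, F i = (∏ i, (splitTuple ht F).1 i) * (∏ i, (splitTuple ht F).2.1 i)
      * ∏ i, (splitTuple ht F).2.2 i := by
  have h : t + (t + (2 * r - 2 * t)) = 2 * r := by omega
  rw [← Fin.prod_congr' F h, Fin.prod_univ_add, Fin.prod_univ_add, ← mul_assoc]
  congr 1
  refine Finset.prod_congr rfl fun i _ => congrArg F (Fin.ext ?_)
  simp
  omega

/-- The index map exchanging the first two blocks of length `t`. -/
def blockSwapFun (ht : t ≤ r) (i : Fin (2 * r)) : Fin (2 * r) :=
  ⟨if i.1 < t then t + i.1 else if i.1 < 2 * t then i.1 - t else i.1, by split_ifs <;> omega⟩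

/-- The permutation exchanging the first two blocks of length `t`. -/
def blockSwap (ht : t ≤ r) : Equiv.Perm (Fin (2 * r)) :=
  Function.Involutive.toPerm (blockSwapFun ht) fun i => by
    apply Fin.ext
    dsimp only [blockSwapFun]
    split_ifs <;> omega

lemma splitTuple_comp_blockSwap (ht : t ≤ r) (z : Fin (2 * r) → S) :
    splitTuple ht (z ∘ blockSwap ht)
      = ((splitTuple ht z).2.1, (splitTuple ht z).1, (splitTuple ht z).2.2) := by
  simp only [splitTuple, Prod.mk.injEq]
  refine ⟨?_, ?_, ?_⟩ <;> funext s <;> have := s.isLt <;> refine congrArg z (Fin.ext ?_) <;>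
    change (blockSwapFun ht _).1 = _ <;> dsimp only [blockSwapFun] <;> split_ifs <;> omega

end Split

/-- The outer components of two tuples of pairs. -/
def outer {X Y Z κ : Type*} (ω : (κ → X × Y) × (κ → Y × Z)) : κ → X × Z :=
  fun i => ((ω.1 i).1, (ω.2 i).2)

section Feasible

variable {X Y Z : Type*} [MeasurableSpace X] [MeasurableSpace Y] [MeasurableSpace Z] {r t : ℕ}

lemma isPosSemidef_map_splitTuple {P : Measure (Fin (2 * r) → X × Y)} (hS : SymCond r P)
    (hP : PSDCond r P) (ht : t ≤ r) : IsPosSemidef (P.map (splitTuple ht)) := by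
  have hm := measurable_splitTuple (S := X × Y) ht
  refine ⟨?_, fun φ γ hφ hφb hγ hγb hγ0 => ?_⟩
  · rw [Measure.map_map (by fun_prop) hm]
    conv_rhs => rw [← hS (blockSwap ht), Measure.map_map hm
      (by unfold Function.comp; fun_prop)]
    congr 1
    funext z
    exact (splitTuple_comp_blockSwap ht z).symm
  · rw [integral_map hm.aemeasurable (by fun_prop)]
    exact hP t ht φ γ hφ hφb hγ hγb hγ0

lemma measurable_outer {κ : Type*} :
    Measurable (outer : (κ → X × Y) × (κ → Y × Z) → κ → X × Z) := by
  unfold outer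
  fun_prop

lemma symCond_glue {P : Measure (Fin (2 * r) → X × Y)} {Q : Measure (Fin (2 * r) → Y × Z)}
    [SFinite P] [SFinite Q] {w : Y → Y → ℝ≥0} (hw : Measurable fun z : Y × Y => w z.1 z.2)
    (hP : SymCond r P) (hQ : SymCond r Q) :
    SymCond r ((glue P Q w Prod.snd Prod.fst).map outer) := by
  intro σ
  conv_rhs => rw [← glue_map_comp_perm hw measurable_snd measurable_fst σ (hP σ) (hQ σ)]
  rw [Measure.map_map (by unfold Function.comp; fun_prop) measurable_outer,
    Measure.map_map measurable_outer (by unfold Function.comp; fun_prop)]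
  rfl

lemma marCond_glue {P : Measure (Fin (2 * r) → X × Y)} {Q : Measure (Fin (2 * r) → Y × Z)}
    [IsProbabilityMeasure P] [IsProbabilityMeasure Q] {w : Y → Y → ℝ≥0}
    {μ : Measure X} {ν : Measure Y} {κ : Measure Z} [IsProbabilityMeasure μ]
    [IsProbabilityMeasure κ] (hw : Measurable fun z : Y × Y => w z.1 z.2)
    (hw1 : ∀ᵐ y ∂ν, ∫⁻ y', w y y' ∂ν = 1) (hsymm : ∀ y y', w y y' = w y' y)
    [IsFiniteMeasure (glue P Q w Prod.snd Prod.fst)]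
    (hP : MarCond r μ ν P) (hQ : MarCond r ν κ Q) :
    MarCond r μ κ ((glue P Q w Prod.snd Prod.fst).map outer) := by
  intro i
  have hdA := measurable_dropAt (A := X × Y) i
  have hdB := measurable_dropAt (A := Y × Z) i
  have hdC := measurable_dropAt (A := X × Z) i
  have ho := measurable_outer (X := X) (Y := Y) (Z := Z) (κ := Fin (2 * r))
  have ho' := measurable_outer (X := X) (Y := Y) (Z := Z) (κ := {j : Fin (2 * r) // j ≠ i})
  have hdrop : ((glue P Q w Prod.snd Prod.fst).map outer).map (dropAt i)
      = ((glue P Q w Prod.snd Prod.fst).map fun ω => (dropAt i ω.1, dropAt i ω.2)).map outer := by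
    rw [Measure.map_map hdC ho, Measure.map_map ho' (by fun_prop)]
    rfl
  change ((glue P Q w Prod.snd Prod.fst).map outer).map (fun z => ((z i).1, dropAt i z))
      = μ.prod (((glue P Q w Prod.snd Prod.fst).map outer).map (dropAt i)) ∧
    ((glue P Q w Prod.snd Prod.fst).map outer).map (fun z => ((z i).2, dropAt i z))
      = κ.prod (((glue P Q w Prod.snd Prod.fst).map outer).map (dropAt i))
  rw [hdrop]
  constructor
  · have h := glue_map_fst_dropAt (P := P) (Q := Q) hw measurable_snd measurable_fst measurable_fst
      hw1 i (map_eq_of_map_prod measurable_snd (hP i).2) (hP i).1 (hQ i).1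
    have h2 := congrArg (Measure.map (Prod.map id outer)) h
    rw [← Measure.map_prod_map _ _ measurable_id ho', Measure.map_id,
      Measure.map_map (by fun_prop) (by fun_prop)] at h2
    rw [← h2, Measure.map_map (by fun_prop) ho]
    rfl
  · have hswap := glue_map_swap (P := P) (Q := Q) hw measurable_snd measurable_fst hsymm
    have : IsFiniteMeasure (glue Q P w Prod.fst Prod.snd) := by
      rw [← hswap]
      infer_instance
    have h := glue_map_fst_dropAt (P := Q) (Q := P) hw measurable_fst measurable_snd measurable_snd
      hw1 i (map_eq_of_map_prod measurable_fst (hQ i).1) (hQ i).2 (hP i).2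
    rw [← hswap, Measure.map_map (by fun_prop) measurable_swap,
      Measure.map_map (by fun_prop) measurable_swap] at h
    have h2 := congrArg (Measure.map (Prod.map id (outer ∘ Prod.swap))) h
    rw [← Measure.map_prod_map _ _ measurable_id (by fun_prop), Measure.map_id,
      Measure.map_map (by fun_prop) (by fun_prop),
      Measure.map_map (by fun_prop) (by fun_prop)] at h2
    rw [Measure.map_map (by fun_prop) ho, Measure.map_map ho' (by fun_prop)]
    exact h2

end Feasible

lemma abs_prod_weight_mul_le {X Y Z : Type*} {n : ℕ} {w : Y → Y → ℝ≥0} {C : ℝ≥0}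
    (hC : ∀ y y', w y y' ≤ C) {f : (Fin n → X × Z) → ℝ} {M : ℝ} (hM : ∀ u, |f u| ≤ M)
    (u : (Fin n → X × Y) × (Fin n → Y × Z)) :
    |((∏ i, w (u.1 i).2 (u.2 i).1 : ℝ≥0) : ℝ) * f (outer u)| ≤ (C : ℝ) ^ n * M := by
  rw [abs_mul, abs_of_nonneg (NNReal.coe_nonneg _)]
  have h : ∏ i, w (u.1 i).2 (u.2 i).1 ≤ C ^ n := by
    simpa using Finset.prod_le_pow_card Finset.univ (fun i => w (u.1 i).2 (u.2 i).1) C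
      fun i _ => hC _ _
  have h' : ((∏ i, w (u.1 i).2 (u.2 i).1 : ℝ≥0) : ℝ) ≤ (C : ℝ) ^ n := by exact_mod_cast h
  exact mul_le_mul h' (hM _) (abs_nonneg _) (by positivity)

section Feasible

variable {X Y Z : Type*}
  [MetricSpace X] [SecondCountableTopology X] [MeasurableSpace X] [BorelSpace X]
  [MetricSpace Y] [SecondCountableTopology Y] [MeasurableSpace Y] [BorelSpace Y]
  [MetricSpace Z] [SecondCountableTopology Z] [MeasurableSpace Z] [BorelSpace Z] {r : ℕ}

lemma psdCond_glue {P : Measure (Fin (2 * r) → X × Y)} {Q : Measure (Fin (2 * r) → Y × Z)}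
    [IsProbabilityMeasure P] [IsProbabilityMeasure Q] {w : Y → Y → ℝ≥0} {C : ℝ≥0}
    (hw : Measurable fun z : Y × Y => w z.1 z.2) (hC : ∀ y y', w y y' ≤ C)
    (hPS : SymCond r P) (hP : PSDCond r P) (hQS : SymCond r Q) (hQ : PSDCond r Q) :
    PSDCond r ((glue P Q w Prod.snd Prod.fst).map outer) := by
  rintro t ht f g hf ⟨M, hM⟩ hg ⟨N, hN⟩ hg0
  have hmP := measurable_splitTuple (S := X × Y) ht
  have hmQ := measurable_splitTuple (S := Y × Z) ht
  have : IsProbabilityMeasure (P.map (splitTuple ht)) :=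
    Measure.isProbabilityMeasure_map hmP.aemeasurable
  have : IsProbabilityMeasure (Q.map (splitTuple ht)) :=
    Measure.isProbabilityMeasure_map hmQ.aemeasurable
  have hw' : ∀ n : ℕ, Measurable fun u : (Fin n → X × Y) × (Fin n → Y × Z) =>
      ((∏ i, w (u.1 i).2 (u.2 i).1 : ℝ≥0) : ℝ) := fun n =>
    (measurable_prod_weight hw measurable_snd measurable_fst).coe_nnreal_real
  have ho : ∀ n : ℕ, Measurable (outer : (Fin n → X × Y) × (Fin n → Y × Z) → _) := fun n =>
    measurable_outer
  have h := (isPosSemidef_map_splitTuple hPS hP ht).integral_prod_nonneg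
    (isPosSemidef_map_splitTuple hQS hQ ht)
    (fun u => ((∏ i, w (u.1 i).2 (u.2 i).1 : ℝ≥0) : ℝ) * f (outer u))
    (fun u => ((∏ i, w (u.1 i).2 (u.2 i).1 : ℝ≥0) : ℝ) * g (outer u))
    ((hw' _).mul (hf.comp (ho _))) (abs_prod_weight_mul_le hC hM)
    ((hw' _).mul (hg.comp (ho _))) (abs_prod_weight_mul_le hC hN)
    (fun u => mul_nonneg (NNReal.coe_nonneg _) (hg0 _))
  rw [Measure.map_prod_map _ _ hmP hmQ, integral_map (by fun_prop)] at h
  · rw [integral_map (ho _).aemeasurable (Measurable.aestronglyMeasurable (by fun_prop)), glue,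
      integral_withDensity_eq_integral_smul
        (measurable_prod_weight hw measurable_snd measurable_fst)]
    refine h.trans_eq (integral_congr_ae (ae_of_all _ fun ω => ?_))
    dsimp only
    rw [prod_split ht, NNReal.smul_def, smul_eq_mul, NNReal.coe_mul, NNReal.coe_mul]
    unfold splitTuple outer
    simp only [Prod.map]
    ring
  · have := hw' t
    have := hw' (2 * r - 2 * t)
    have := ho t
    have := ho (2 * r - 2 * t)
    exact Measurable.aestronglyMeasurable (by fun_prop)

/-- Feasible measures can be glued along any finite measurable partition of the middle space. -/
lemma exists_glue {I : Type*} [MeasurableSpace I] [Finite I] [MeasurableSingletonClass I]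
    {μ : Measure X} {ν : Measure Y} {κ : Measure Z} [IsProbabilityMeasure μ]
    [IsProbabilityMeasure ν] [IsProbabilityMeasure κ] {P : Measure (Fin (2 * r) → X × Y)}
    {Q : Measure (Fin (2 * r) → Y × Z)} (hP : P ∈ PiRSet r μ ν) (hQ : Q ∈ PiRSet r ν κ)
    {c : Y → I} (hc : Measurable c) :
    ∃ M : Measure ((Fin (2 * r) → X × Y) × (Fin (2 * r) → Y × Z)), IsProbabilityMeasure M ∧
      M.map Prod.fst = P ∧ M.map Prod.snd = Q ∧ M.map outer ∈ PiRSet r μ κ ∧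
      ∀ᵐ ω ∂M, ∀ i, c (ω.1 i).2 = c (ω.2 i).1 := by
  obtain ⟨_, hPS, hPM, hPP⟩ := hP
  obtain ⟨_, hQS, hQM, hQP⟩ := hQ
  have hw := measurable_cellWeight ν hc
  have hw1 := lintegral_cellWeight ν hc
  obtain ⟨C, hC⟩ := exists_cellWeight_le ν c
  have hfst : (glue P Q (cellWeight ν c) Prod.snd Prod.fst).map Prod.fst = P :=
    glue_map_fst hw measurable_snd measurable_fst hw1
      (fun i => map_eq_of_map_prod measurable_snd (hPM i).2) (fun i => (hQM i).1)
  have hsnd : (glue P Q (cellWeight ν c) Prod.snd Prod.fst).map Prod.snd = Q := by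
    have h := glue_map_fst (P := Q) (Q := P) hw measurable_fst measurable_snd hw1
      (fun i => map_eq_of_map_prod measurable_fst (hQM i).1) (fun i => (hPM i).2)
    rwa [← glue_map_swap hw measurable_snd measurable_fst (cellWeight_comm ν c),
      Measure.map_map measurable_fst measurable_swap] at h
  have hprob : IsProbabilityMeasure (glue P Q (cellWeight ν c) Prod.snd Prod.fst) := by
    rw [← Measure.isProbabilityMeasure_map_iff measurable_fst.aemeasurable, hfst]
    infer_instance
  refine ⟨_, hprob, hfst, hsnd, ⟨Measure.isProbabilityMeasure_map measurable_outer.aemeasurable,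
    symCond_glue hw hPS hQS, marCond_glue hw hw1 (cellWeight_comm ν c) hPM hQM,
    psdCond_glue hw hC hPS hPP hQS hQP⟩, ?_⟩
  filter_upwards [ae_glue_weight_ne_zero (P := P) (Q := Q) hw measurable_snd measurable_fst]
    with ω hω i using eq_of_cellWeight_ne_zero (hω i)

end Feasible

section Product

variable {X Y S : Type*} [MeasurableSpace X] [MeasurableSpace Y] [MeasurableSpace S] {r t : ℕ}

/-- The inverse of `splitTuple`. -/
def joinTuple {S : Type*} (u : (Fin t → S) × (Fin t → S) × (Fin (2 * r - 2 * t) → S))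
    (i : Fin (2 * r)) : S :=
  if h : i.1 < t then u.1 ⟨i.1, h⟩
  else if h' : i.1 < 2 * t then u.2.1 ⟨i.1 - t, by omega⟩
  else u.2.2 ⟨i.1 - 2 * t, by omega⟩

lemma splitTuple_joinTuple {S : Type*} (ht : t ≤ r)
    (u : (Fin t → S) × (Fin t → S) × (Fin (2 * r - 2 * t) → S)) :
    splitTuple ht (joinTuple u) = u := by
  obtain ⟨a, b, c⟩ := u
  simp only [splitTuple, joinTuple, Prod.mk.injEq]
  refine ⟨?_, ?_, ?_⟩ <;> funext s <;> have := s.isLt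
  · simp
  · rw [dif_neg (by omega), dif_pos (by omega)]
    exact congrArg b (Fin.ext (by simp))
  · rw [dif_neg (by omega), dif_neg (by omega)]
    exact congrArg c (Fin.ext (by simp))

lemma joinTuple_splitTuple {S : Type*} (ht : t ≤ r) (z : Fin (2 * r) → S) :
    joinTuple (splitTuple ht z) = z := by
  funext i
  simp only [splitTuple, joinTuple]
  split_ifs
  · rfl
  all_goals exact congrArg z (Fin.ext (by dsimp only; omega))

lemma measurable_joinTuple : Measurable
    (joinTuple : (Fin t → S) × (Fin t → S) × (Fin (2 * r - 2 * t) → S) → Fin (2 * r) → S) := by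
  refine measurable_pi_lambda _ fun i => ?_
  unfold joinTuple
  split_ifs <;> fun_prop

lemma map_splitTuple_pi (ht : t ≤ r) (π : Measure S) [IsProbabilityMeasure π] :
    (Measure.pi fun _ : Fin (2 * r) => π).map (splitTuple ht)
      = (Measure.pi fun _ => π).prod ((Measure.pi fun _ => π).prod (Measure.pi fun _ => π)) := by
  have h : Measure.pi (fun _ : Fin (2 * r) => π)
      = ((Measure.pi fun _ => π).prod
        ((Measure.pi fun _ => π).prod (Measure.pi fun _ => π))).map
        (joinTuple (r := r) (t := t)) := by
    refine Measure.pi_eq fun s hs => ?_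
    have hpre : joinTuple ⁻¹' Set.pi univ s
        = Set.pi univ (splitTuple ht s).1 ×ˢ
          (Set.pi univ (splitTuple ht s).2.1 ×ˢ Set.pi univ (splitTuple ht s).2.2) := by
      ext u
      have hall : ∀ p : Fin (2 * r) → Prop, (∀ i, p i) ↔ (∀ i, (splitTuple ht p).1 i) ∧
          (∀ i, (splitTuple ht p).2.1 i) ∧ (∀ i, (splitTuple ht p).2.2 i) := fun p => by
        refine ⟨fun h => ⟨fun i => h _, fun i => h _, fun i => h _⟩, fun ⟨h1, h2, h3⟩ => ?_⟩
        rw [← joinTuple_splitTuple ht p]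
        intro i
        unfold joinTuple
        split_ifs
        exacts [h1 _, h2 _, h3 _]
      obtain ⟨z, rfl⟩ : ∃ z, splitTuple ht z = u := ⟨_, splitTuple_joinTuple ht u⟩
      simp only [mem_preimage, joinTuple_splitTuple, Set.mem_pi, mem_univ, true_implies, mem_prod]
      exact hall _
    rw [Measure.map_apply measurable_joinTuple (MeasurableSet.univ_pi hs), hpre,
      Measure.prod_prod, Measure.prod_prod, Measure.pi_pi, Measure.pi_pi, Measure.pi_pi,
      prod_split ht, mul_assoc]
    rfl
  rw [h, Measure.map_map (measurable_splitTuple ht) measurable_joinTuple]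
  convert Measure.map_id using 2
  exact funext fun u => splitTuple_joinTuple ht u

lemma map_pi_dropAt {ι : Type*} [Fintype ι] [DecidableEq ι] (π : Measure S)
    [IsProbabilityMeasure π] {x : S → X} (hx : Measurable x) (i : ι) :
    (Measure.pi fun _ : ι => π).map (fun z => (x (z i), dropAt i z))
      = (π.map x).prod ((Measure.pi fun _ : ι => π).map (dropAt i)) := by
  have hind := (ProbabilityTheory.iIndepFun_pi (μ := fun _ : ι => π) (X := fun _ => id)
    fun _ => aemeasurable_id).indepFun_finset {i} {i}ᶜ disjoint_compl_right
    fun j => measurable_pi_apply j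
  have hind' := hind.comp (φ := fun u => x (u ⟨i, Finset.mem_singleton_self i⟩))
    (ψ := fun (v : ({i}ᶜ : Finset ι) → S) (j : {j // j ≠ i}) => v ⟨j.1, by simpa using j.2⟩)
    (by fun_prop) (by fun_prop)
  have h := (ProbabilityTheory.indepFun_iff_map_prod_eq_prod_map_map
    (hx.comp (measurable_pi_apply i)).aemeasurable (measurable_dropAt i).aemeasurable).1 hind'
  have hmap : (Measure.pi fun _ : ι => π).map (fun z => x (z i)) = π.map x := by
    conv_rhs => rw [← (measurePreserving_eval (fun _ : ι => π) i).map_eq,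
      Measure.map_map hx (measurable_pi_apply i)]
    rfl
  rw [← hmap]
  exact h

lemma pi_mem_PiRSet (μ : Measure X) (ν : Measure Y) [IsProbabilityMeasure μ]
    [IsProbabilityMeasure ν] : Measure.pi (fun _ => μ.prod ν) ∈ PiRSet r μ ν := by
  refine ⟨inferInstance, fun σ => ?_, fun i => ⟨?_, ?_⟩, ?_⟩
  · exact (measurePreserving_arrowCongr' (μ := fun _ => μ.prod ν) (ν := fun _ => μ.prod ν) σ.symm
      (MeasurableEquiv.refl (X × Y)) fun _ => MeasurePreserving.id _).map_eq
  · have h := map_pi_dropAt (μ.prod ν) measurable_fst i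
    rwa [Measure.map_fst_prod, measure_univ, one_smul] at h
  · have h := map_pi_dropAt (μ.prod ν) measurable_snd i
    rwa [Measure.map_snd_prod, measure_univ, one_smul] at h
  · intro t ht f g hf _ hg _ hg0
    have h := integral_map (μ := Measure.pi fun _ : Fin (2 * r) => μ.prod ν)
      (measurable_splitTuple ht).aemeasurable
      (f := fun u => f u.1 * (f u.2.1 * g u.2.2)) (by fun_prop)
    simp only [← mul_assoc] at h
    refine le_of_le_of_eq ?_ h
    simp only [mul_assoc]
    rw [map_splitTuple_pi,
      integral_prod_mul f fun v : (Fin t → X × Y) × (Fin (2 * r - 2 * t) → X × Y) => f v.1 * g v.2,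
      integral_prod_mul f g, ← mul_assoc]
    exact mul_nonneg (mul_self_nonneg _) (integral_nonneg hg0)

end Product

section Triangle

lemma integral_abs_add_rpow_le {Ω : Type*} [MeasurableSpace Ω] {M : Measure Ω} {p : ℝ}
    (hp : 1 ≤ p) {A B : Ω → ℝ} (hA : MemLp A (ENNReal.ofReal p) M)
    (hB : MemLp B (ENNReal.ofReal p) M) :
    (∫ ω, |A ω + B ω| ^ p ∂M) ^ (1 / p)
      ≤ (∫ ω, |A ω| ^ p ∂M) ^ (1 / p) + (∫ ω, |B ω| ^ p ∂M) ^ (1 / p) := by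
  have hp0 : 0 < p := by linarith
  have hne : ENNReal.ofReal p ≠ 0 := by simpa using hp0
  have key : ∀ {F : Ω → ℝ}, MemLp F (ENNReal.ofReal p) M →
      eLpNorm F (ENNReal.ofReal p) M = ENNReal.ofReal ((∫ ω, |F ω| ^ p ∂M) ^ (1 / p)) := by
    intro F hF
    rw [hF.eLpNorm_eq_integral_rpow_norm hne ENNReal.ofReal_ne_top,
      ENNReal.toReal_ofReal hp0.le, one_div]
    rfl
  have h := eLpNorm_add_le hA.1 hB.1 (p := ENNReal.ofReal p) (by simpa using hp)
  have hnn : ∀ F : Ω → ℝ, 0 ≤ (∫ ω, |F ω| ^ p ∂M) ^ (1 / p) := fun F => by positivity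
  rw [key (hA.add hB), key hA, key hB, ← ENNReal.ofReal_add (hnn A) (hnn B),
    ENNReal.ofReal_le_ofReal_iff (add_nonneg (hnn A) (hnn B))] at h
  exact h

/-- A compact metric space has a finite measurable partition into small cells. -/
lemma exists_measurable_cells {Y : Type*} [MetricSpace Y] [CompactSpace Y] [MeasurableSpace Y]
    [BorelSpace Y] {δ : ℝ} (hδ : 0 < δ) :
    ∃ (s : Finset Y) (c : Y → s → Prop), Measurable c ∧ ∀ y y', c y = c y' → dist y y' < δ := by
  obtain ⟨s, -, hs, hcover⟩ := finite_cover_balls_of_compact (isCompact_univ (X := Y)) (half_pos hδ)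
  refine ⟨hs.toFinset, fun y a => y ∈ ball a.1 (δ / 2), ?_, fun y y' h => ?_⟩
  · exact measurable_pi_lambda _ fun a => measurable_mem.2 measurableSet_ball
  · have hy := hcover (mem_univ y)
    simp only [mem_iUnion] at hy
    obtain ⟨a, ha, hya⟩ := hy
    have hy' : y' ∈ ball a (δ / 2) := by
      exact (iff_of_eq (congrFun h ⟨a, hs.mem_toFinset.2 ha⟩)).1 hya
    linarith [dist_triangle_right y y' a, mem_ball.1 hya, mem_ball.1 hy']

lemma distCost_nonneg {X Y : Type*} [PseudoMetricSpace X] [PseudoMetricSpace Y] (p q : ℝ)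
    (z w : X × Y) : 0 ≤ distCost p q z w :=
  Real.rpow_nonneg (abs_nonneg _) _

lemma bddBelow_integral_distCost {X Y : Type*} [PseudoMetricSpace X] [MeasurableSpace X]
    [PseudoMetricSpace Y] [MeasurableSpace Y] {r : ℕ} (μ : Measure X) (ν : Measure Y) (p q : ℝ)
    (i j : Fin (2 * r)) :
    BddBelow (range fun P : PiRSet r μ ν =>
      ∫ z, distCost p q (z i) (z j) ∂(P : Measure (Fin (2 * r) → X × Y))) :=
  ⟨0, by
    rintro _ ⟨P, rfl⟩
    exact integral_nonneg fun z => distCost_nonneg _ _ _ _⟩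

lemma exists_integral_distCost_rpow_lt {X Y : Type*} [PseudoMetricSpace X] [MeasurableSpace X]
    [PseudoMetricSpace Y] [MeasurableSpace Y] {r : ℕ} (μ : Measure X) (ν : Measure Y)
    [IsProbabilityMeasure μ] [IsProbabilityMeasure ν] {p q ε : ℝ} (hp : 1 ≤ p) (hr : 0 < r)
    (hε : 0 < ε) :
    ∃ P ∈ PiRSet r μ ν,
      (∫ z, distCost p q (z ⟨0, by omega⟩) (z ⟨1, by omega⟩) ∂P) ^ (1 / p)
        < (gwRVal r hr (distCost p q) μ ν) ^ (1 / p) + ε := by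
  have hcont : ContinuousAt (fun s : ℝ => s ^ (1 / p)) (gwRVal r hr (distCost p q) μ ν) :=
    Real.continuousAt_rpow_const _ _ (Or.inr (by positivity))
  obtain ⟨δ, hδ, h⟩ := Metric.continuousAt_iff.1 hcont ε hε
  have : Nonempty (PiRSet r μ ν) := ⟨⟨_, pi_mem_PiRSet μ ν⟩⟩
  obtain ⟨⟨P, hP⟩, hlt⟩ := exists_lt_of_ciInf_lt (lt_add_of_pos_right
    (gwRVal r hr (distCost p q) μ ν) hδ)
  have hle : gwRVal r hr (distCost p q) μ ν
      ≤ ∫ z, distCost p q (z ⟨0, by omega⟩) (z ⟨1, by omega⟩) ∂P :=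
    ciInf_le (bddBelow_integral_distCost μ ν p q _ _) ⟨P, hP⟩
  refine ⟨P, hP, ?_⟩
  have h' := h (x := ∫ z, distCost p q (z ⟨0, by omega⟩) (z ⟨1, by omega⟩) ∂P) (by
    rw [Real.dist_eq, abs_lt]
    constructor <;> linarith)
  rw [Real.dist_eq] at h'
  linarith [(abs_lt.1 h').2]

lemma continuous_dist_rpow {A X : Type*} [TopologicalSpace A] [PseudoMetricSpace X] {q : ℝ}
    (hq : 0 ≤ q) {f g : A → X} (hf : Continuous f) (hg : Continuous g) :
    Continuous fun a => dist (f a) (g a) ^ q :=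
  (hf.dist hg).rpow_const fun _ => Or.inr hq

lemma continuous_distCost {A X Y : Type*} [TopologicalSpace A] [PseudoMetricSpace X]
    [PseudoMetricSpace Y] {p q : ℝ} (hp : 0 ≤ p) (hq : 0 ≤ q) {f g : A → X × Y}
    (hf : Continuous f) (hg : Continuous g) : Continuous fun a => distCost p q (f a) (g a) :=
  ((continuous_dist_rpow hq hf.fst hg.fst).sub
    (continuous_dist_rpow hq hf.snd hg.snd)).abs.rpow_const fun _ => Or.inr hp

variable {X Y Z : Type*}
  [MetricSpace X] [CompactSpace X] [MeasurableSpace X] [BorelSpace X]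
  [MetricSpace Y] [CompactSpace Y] [MeasurableSpace Y] [BorelSpace Y]
  [MetricSpace Z] [CompactSpace Z] [MeasurableSpace Z] [BorelSpace Z] {r : ℕ}

lemma gwRVal_rpow_le_add_add {μ : Measure X} {ν : Measure Y} {κ : Measure Z}
    [IsProbabilityMeasure μ] [IsProbabilityMeasure ν] [IsProbabilityMeasure κ]
    {p q η : ℝ} (hp : 1 ≤ p) (hq : 1 ≤ q) (hr : 0 < r) (hη : 0 < η)
    {P : Measure (Fin (2 * r) → X × Y)} {Q : Measure (Fin (2 * r) → Y × Z)}
    (hP : P ∈ PiRSet r μ ν) (hQ : Q ∈ PiRSet r ν κ) :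
    (gwRVal r hr (distCost p q) μ κ) ^ (1 / p)
      ≤ (∫ z, distCost p q (z ⟨0, by omega⟩) (z ⟨1, by omega⟩) ∂P) ^ (1 / p)
        + η + (∫ z, distCost p q (z ⟨0, by omega⟩) (z ⟨1, by omega⟩) ∂Q) ^ (1 / p) := by
  have hp0 : 0 < p := by linarith
  have hq0 : 0 ≤ q := by linarith
  obtain ⟨δ, hδ, hδη⟩ := Metric.uniformContinuous_iff.1
    (CompactSpace.uniformContinuous_of_continuous
      (continuous_dist_rpow hq0 continuous_fst continuous_snd :
        Continuous fun y : Y × Y => dist y.1 y.2 ^ q)) η hη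
  obtain ⟨s, c, hc, hcδ⟩ := exists_measurable_cells (Y := Y) hδ
  obtain ⟨M, hM, hMP, hMQ, hMo, hcell⟩ := exists_glue hP hQ hc
  set i : Fin (2 * r) := ⟨0, by omega⟩
  set j : Fin (2 * r) := ⟨1, by omega⟩
  let FX : (Fin (2 * r) → X × Y) × (Fin (2 * r) → Y × Z) → ℝ :=
    fun ω => dist (ω.1 i).1 (ω.1 j).1 ^ q
  let FY : (Fin (2 * r) → X × Y) × (Fin (2 * r) → Y × Z) → ℝ :=
    fun ω => dist (ω.1 i).2 (ω.1 j).2 ^ q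
  let FY' : (Fin (2 * r) → X × Y) × (Fin (2 * r) → Y × Z) → ℝ :=
    fun ω => dist (ω.2 i).1 (ω.2 j).1 ^ q
  let FZ : (Fin (2 * r) → X × Y) × (Fin (2 * r) → Y × Z) → ℝ :=
    fun ω => dist (ω.2 i).2 (ω.2 j).2 ^ q
  have hFX : Continuous FX := continuous_dist_rpow hq0 (by fun_prop) (by fun_prop)
  have hFY : Continuous FY := continuous_dist_rpow hq0 (by fun_prop) (by fun_prop)
  have hFY' : Continuous FY' := continuous_dist_rpow hq0 (by fun_prop) (by fun_prop)
  have hFZ : Continuous FZ := continuous_dist_rpow hq0 (by fun_prop) (by fun_prop)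
  have hmem : ∀ {F : (Fin (2 * r) → X × Y) × (Fin (2 * r) → Y × Z) → ℝ}, Continuous F →
      MemLp F (ENNReal.ofReal p) M := fun hF =>
    hF.memLp_of_hasCompactSupport (HasCompactSupport.of_compactSpace _)
  have h₁ := integral_abs_add_rpow_le hp (hmem (hFX.sub hFY)) (hmem (hFY.sub hFZ))
  have h₂ := integral_abs_add_rpow_le hp (hmem (hFY.sub hFY')) (hmem (hFY'.sub hFZ))
  simp only [Pi.sub_apply, sub_add_sub_cancel] at h₁ h₂
  have hsmall : (∫ ω, |FY ω - FY' ω| ^ p ∂M) ^ (1 / p) ≤ η := by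
    have hle : ∫ ω, |FY ω - FY' ω| ^ p ∂M ≤ η ^ p := by
      have : ∫ ω, |FY ω - FY' ω| ^ p ∂M ≤ ∫ _, η ^ p ∂M := by
        refine integral_mono_of_nonneg (ae_of_all _ fun ω => by positivity)
          (integrable_const _) ?_
        filter_upwards [hcell] with ω hω
        refine Real.rpow_le_rpow (abs_nonneg _) ?_ hp0.le
        have := hδη (a := ((ω.1 i).2, (ω.1 j).2)) (b := ((ω.2 i).1, (ω.2 j).1))
          (max_lt (hcδ _ _ (hω i)) (hcδ _ _ (hω j)))
        exact this.le
      simpa using this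
    calc _ ≤ (η ^ p) ^ (1 / p) := Real.rpow_le_rpow (by positivity) hle (by positivity)
      _ = η := by rw [one_div, Real.rpow_rpow_inv hη.le hp0.ne']
  have hPi : ∫ z, distCost p q (z i) (z j) ∂P = ∫ ω, |FX ω - FY ω| ^ p ∂M := by
    rw [← hMP, integral_map measurable_fst.aemeasurable
      (continuous_distCost hp0.le hq0 (by fun_prop) (by fun_prop)).aestronglyMeasurable]
    rfl
  have hQi : ∫ z, distCost p q (z i) (z j) ∂Q = ∫ ω, |FY' ω - FZ ω| ^ p ∂M := by
    rw [← hMQ, integral_map measurable_snd.aemeasurable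
      (continuous_distCost hp0.le hq0 (by fun_prop) (by fun_prop)).aestronglyMeasurable]
    rfl
  have hOi : ∫ z, distCost p q (z i) (z j) ∂(M.map outer) = ∫ ω, |FX ω - FZ ω| ^ p ∂M := by
    rw [integral_map measurable_outer.aemeasurable
      (continuous_distCost hp0.le hq0 (by fun_prop) (by fun_prop)).aestronglyMeasurable]
    rfl
  have hle : gwRVal r hr (distCost p q) μ κ ≤ ∫ ω, |FX ω - FZ ω| ^ p ∂M := by
    rw [← hOi]
    exact ciInf_le (bddBelow_integral_distCost μ κ p q i j) ⟨_, hMo⟩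
  have hnn : 0 ≤ gwRVal r hr (distCost p q) μ κ :=
    Real.iInf_nonneg fun _ => integral_nonneg fun _ => distCost_nonneg _ _ _ _
  have hle' := Real.rpow_le_rpow hnn hle (one_div_nonneg.2 hp0.le)
  rw [hPi, hQi]
  linarith

end Triangle

theorem stmt10 {X Y Z : Type*}
    [MetricSpace X] [CompactSpace X] [PolishSpace X] [MeasurableSpace X] [BorelSpace X]
    [MetricSpace Y] [CompactSpace Y] [PolishSpace Y] [MeasurableSpace Y] [BorelSpace Y]
    [MetricSpace Z] [CompactSpace Z] [PolishSpace Z] [MeasurableSpace Z] [BorelSpace Z]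
    (hdX : Metric.diam (Set.univ : Set X) ≤ 1) (hdY : Metric.diam (Set.univ : Set Y) ≤ 1)
    (hdZ : Metric.diam (Set.univ : Set Z) ≤ 1)
    (μ : Measure X) (ν : Measure Y) (κ : Measure Z)
    [IsProbabilityMeasure μ] [IsProbabilityMeasure ν] [IsProbabilityMeasure κ]
    (p q : ℝ) (hp : 1 ≤ p) (hq : 1 ≤ q)
    (r : ℕ) (hr : 0 < r) :
    (gwRVal r hr (distCost p q) μ κ) ^ (1 / p)
      ≤ (gwRVal r hr (distCost p q) μ ν) ^ (1 / p)
        + (gwRVal r hr (distCost p q) ν κ) ^ (1 / p) := by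
  refine le_of_forall_pos_le_add fun ε hε => ?_
  have hε' : 0 < ε / 3 := by positivity
  obtain ⟨P, hP, hPlt⟩ := exists_integral_distCost_rpow_lt (q := q) μ ν hp hr hε'
  obtain ⟨Q, hQ, hQlt⟩ := exists_integral_distCost_rpow_lt (q := q) ν κ hp hr hε'
  linarith [gwRVal_rpow_le_add_add hp hq hr hε' hP hQ]

end GWSOS
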